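/- arXiv:1510.07153 — 2 statements merged into one kernel-verified Lean document; each statement's English description precedes it below -/
import Mathlib

section
/- Let (X, μ) be a measure space, let (g_k)_{k∈ℕ} and (f_j)_{j∈ℕ} be sequences of probability density functions on X (nonnegative integrable functions with ∫ g_k dμ = ∫ f_j dμ = 1), and suppose each f_j lies in the L¹(μ)-closure of the set {g_k : k ∈ ℕ}. Then for every sequence of nonnegative weights (w_j)_{j∈ℕ} with Σ_j w_j = 1 and every ε > 0, there exists a sequence of nonnegative weights (q_k)_{k∈ℕ} with Σ_k q_k = 1 such that ‖Σ_k q_k g_k − Σ_j w_j f_j‖_{L¹(μ)} < ε. -/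
open MeasureTheory

theorem aux_tsum {X : Type*} [MeasurableSpace X] (μ : Measure X) (F : ℕ → X → ℝ)
    (h0 : ∀ j x, 0 ≤ F j x) (hi : ∀ j, Integrable (F j) μ)
    (hs : Summable fun j => ∫ x, F j x ∂μ) :
    (∀ᵐ x ∂μ, Summable fun j => F j x) ∧ Integrable (fun x => ∑' j, F j x) μ := by
  have hm : ∀ j, AEMeasurable (fun x => ENNReal.ofReal (F j x)) μ :=
    fun j => (hi j).aemeasurable.ennreal_ofReal
  have hfin : ∫⁻ x, ∑' j, ENNReal.ofReal (F j x) ∂μ ≠ ⊤ := by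
    rw [lintegral_tsum hm]
    have : ∀ j, ∫⁻ x, ENNReal.ofReal (F j x) ∂μ = ENNReal.ofReal (∫ x, F j x ∂μ) := fun j =>
      (ofReal_integral_eq_lintegral_ofReal (hi j) (Filter.Eventually.of_forall (h0 j))).symm
    simp_rw [this]
    exact hs.tsum_ofReal_ne_top
  have hm' : AEMeasurable (fun x => ∑' j, ENNReal.ofReal (F j x)) μ := AEMeasurable.tsum hm
  have heq : ∀ x, (∑' j, ENNReal.ofReal (F j x)).toReal = ∑' j, F j x := fun x => by
    rw [ENNReal.tsum_toReal_eq (fun _ => ENNReal.ofReal_ne_top)]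
    exact tsum_congr fun j => ENNReal.toReal_ofReal (h0 j x)
  refine ⟨?_, ?_⟩
  · filter_upwards [ae_lt_top' hm' hfin] with x hx
    have := ENNReal.summable_toReal hx.ne
    simpa only [ENNReal.toReal_ofReal (h0 _ x)] using this
  · have := integrable_toReal_of_lintegral_ne_top hm' hfin
    simpa only [heq] using this

/-- **Lemma 1 (abstract form).** If each probability density `f j` lies in the
`L¹(μ)`-closure of the family of probability densities `{g k : k ∈ ℕ}`, then any
countable mixture `∑ j, w j * f j` can be approximated arbitrarily well in `L¹(μ)`
by mixtures `∑ k, q k * g k` over the family `(g k)`. -/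
theorem mixture_L1_approx {X : Type*} [MeasurableSpace X] (μ : Measure X)
    (g f : ℕ → X → ℝ)
    (hg_nonneg : ∀ k x, 0 ≤ g k x) (hf_nonneg : ∀ j x, 0 ≤ f j x)
    (hg_int : ∀ k, Integrable (g k) μ) (hf_int : ∀ j, Integrable (f j) μ)
    (hg_prob : ∀ k, ∫ x, g k x ∂μ = 1) (hf_prob : ∀ j, ∫ x, f j x ∂μ = 1)
    (hdense : ∀ j, ∀ δ > (0 : ℝ), ∃ k, ∫ x, |g k x - f j x| ∂μ < δ)
    (w : ℕ → ℝ) (hw_nonneg : ∀ j, 0 ≤ w j) (hw_sum : ∑' j, w j = 1)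
    (ε : ℝ) (hε : 0 < ε) :
    ∃ q : ℕ → ℝ, (∀ k, 0 ≤ q k) ∧ (∑' k, q k = 1) ∧
      ∫ x, |(∑' k, q k * g k x) - ∑' j, w j * f j x| ∂μ < ε := by
  have hws : Summable w := by
    by_contra h
    rw [tsum_eq_zero_of_not_summable h] at hw_sum
    exact zero_ne_one hw_sum
  choose κ hκ using fun j => hdense j (ε / 2) (half_pos hε)
  refine ⟨fun k => ∑' b : κ ⁻¹' {k}, w b, fun k => tsum_nonneg fun b => hw_nonneg b, ?_, ?_⟩
  · rw [← hw_sum]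
    exact (hws.hasSum.tsum_fiberwise κ).tsum_eq
  have hA := (aux_tsum μ (fun j x => w j * g (κ j) x)
    (fun j x => mul_nonneg (hw_nonneg j) (hg_nonneg _ x)) (fun j => (hg_int _).const_mul _)
    (by simpa only [integral_const_mul, hg_prob, mul_one] using hws)).1
  have hB := (aux_tsum μ (fun j x => w j * f j x)
    (fun j x => mul_nonneg (hw_nonneg j) (hf_nonneg _ x)) (fun j => (hf_int _).const_mul _)
    (by simpa only [integral_const_mul, hf_prob, mul_one] using hws)).1
  have hDi : ∀ j, Integrable (fun x => w j * |g (κ j) x - f j x|) μ :=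
    fun j => (((hg_int _).sub (hf_int j)).abs).const_mul _
  have hD0 : ∀ j x, 0 ≤ w j * |g (κ j) x - f j x| :=
    fun j x => mul_nonneg (hw_nonneg j) (abs_nonneg _)
  have hle : ∀ j, ∫ x, w j * |g (κ j) x - f j x| ∂μ ≤ w j * (ε / 2) := fun j => by
    rw [integral_const_mul]
    exact mul_le_mul_of_nonneg_left (hκ j).le (hw_nonneg j)
  have hDs : Summable fun j => ∫ x, w j * |g (κ j) x - f j x| ∂μ :=
    Summable.of_nonneg_of_le (fun j => integral_nonneg (hD0 j)) hle (hws.mul_right _)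
  obtain ⟨hC, hCi⟩ := aux_tsum μ (fun j x => w j * |g (κ j) x - f j x|) hD0 hDi hDs
  have hint : ∫ x, |(∑' k, (∑' b : κ ⁻¹' {k}, w b) * g k x) - ∑' j, w j * f j x| ∂μ
      ≤ ∫ x, ∑' j, w j * |g (κ j) x - f j x| ∂μ := by
    refine integral_mono_of_nonneg (Filter.Eventually.of_forall fun x => abs_nonneg _) hCi ?_
    filter_upwards [hA, hB, hC] with x ha hb hc
    have h1 : ∑' k, (∑' b : κ ⁻¹' {k}, w b) * g k x = ∑' j, w j * g (κ j) x := by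
      rw [← (ha.hasSum.tsum_fiberwise κ).tsum_eq]
      refine tsum_congr fun k => ?_
      rw [← tsum_mul_right]
      refine tsum_congr fun b => ?_
      have hb : κ b = k := b.2
      rw [hb]
    have h2 : ∀ j, w j * |g (κ j) x - f j x| = ‖w j * g (κ j) x - w j * f j x‖ := fun j => by
      rw [← mul_sub, Real.norm_eq_abs, abs_mul, abs_of_nonneg (hw_nonneg j)]
    simp only [h2] at hc ⊢
    rw [h1, ← ha.tsum_sub hb, ← Real.norm_eq_abs]
    exact norm_tsum_le_tsum_norm hc
  refine hint.trans_lt ?_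
  rw [← integral_tsum_of_summable_integral_norm hDi
    (by simpa only [Real.norm_of_nonneg (hD0 _ _)] using hDs)]
  calc _ ≤ ∑' j, w j * (ε / 2) := hDs.tsum_le_tsum hle (hws.mul_right _)
    _ = ε / 2 := by rw [tsum_mul_right, hw_sum, one_mul]
    _ < ε := half_lt_self hε
end

section
/- Define f₁ : ℝ → ℝ by f₁(x) = (2 − x) e^{−(2 − x)} for x < 2 and f₁(x) = 0 for x ≥ 2, and let f₂ : ℝ → ℝ be the normal density with mean 0 and variance 2, f₂(x) = (1/(2√π)) e^{−x²/4}. Then ∫_ℝ f₁(x) f₂(x) dx = 1/(e√π). -/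
open MeasureTheory Real

lemma aux_integral : ∫ r : ℝ in Set.Ioi 0, r * Real.exp (-(1/4) * r ^ 2) = 2 := by
  have h := integral_mul_cexp_neg_mul_sq (b := ((1/4 : ℝ) : ℂ)) (by rw [Complex.ofReal_re]; norm_num)
  have h2 : ∀ r : ℝ, (r : ℂ) * Complex.exp (-((1/4 : ℝ) : ℂ) * (r : ℂ) ^ 2)
      = ((r * Real.exp (-(1/4) * r ^ 2) : ℝ) : ℂ) := by
    intro r
    push_cast
    rfl
  simp_rw [h2] at h
  rw [integral_complex_ofReal] at h
  have h3 : (2 * ((1/4 : ℝ) : ℂ))⁻¹ = ((2 : ℝ) : ℂ) := by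
    push_cast
    norm_num
  rw [h3] at h
  exact Complex.ofReal_injective h

/-- **Cross integral of the reflected Gamma(2,1) density and the N(0,2)
density.** With `f₁` the density of `2 − Y`, `Y ∼ Gamma(2,1)`, and `f₂` the
normal density with mean `0` and variance `2`, one has `∫ f₁ f₂ = 1/(e√π)`. -/
theorem cross_integral_gamma_normal
    (f₁ f₂ : ℝ → ℝ)
    (hf₁ : ∀ x, f₁ x = if x < 2 then (2 - x) * Real.exp (-(2 - x)) else 0)
    (hf₂ : ∀ x, f₂ x = 1 / (2 * Real.sqrt π) * Real.exp (-x ^ 2 / 4)) :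
    ∫ x, f₁ x * f₂ x = 1 / (Real.exp 1 * Real.sqrt π) := by
  rw [← integral_sub_left_eq_self (fun x => f₁ x * f₂ x) volume 2]
  have key : (fun x => f₁ (2 - x) * f₂ (2 - x)) = (Set.Ioi (0 : ℝ)).indicator
      (fun r => (Real.exp (-1) / (2 * Real.sqrt π)) * (r * Real.exp (-(1/4) * r ^ 2))) := by
    funext x
    rw [hf₁, hf₂, Set.indicator_apply]
    by_cases hx : 0 < x
    · rw [if_pos (by linarith), if_pos (Set.mem_Ioi.2 hx)]
      have e : Real.exp (-(2 - (2 - x))) * Real.exp (-(2 - x) ^ 2 / 4)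
          = Real.exp (-1) * Real.exp (-(1/4) * x ^ 2) := by
        rw [← Real.exp_add, ← Real.exp_add]
        congr 1
        ring
      linear_combination (x * (1 / (2 * Real.sqrt π))) * e
    · rw [if_neg (by linarith), if_neg (by simpa using hx), zero_mul]
  rw [key, integral_indicator measurableSet_Ioi, integral_const_mul, aux_integral, Real.exp_neg]
  field_simp
end
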